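/- arXiv:2308.06359 — 3 statements merged into one kernel-verified Lean document; each statement's English description precedes it below -/
import Mathlib

section
/- If b, m, n are positive integers not divisible by p, and c = b·p^r where r ≥ 2k, then σ_{ψ,ε}(m,n;c) = φ(p^j) · S(m,n;c). -/
open Complex Finset

noncomputable def eZMod (c : ℕ) (z : ZMod c) : ℂ :=
  Complex.exp (2 * Real.pi * Complex.I * (z.val : ℂ) / (c : ℂ))

/-- Ordinary Kloosterman sum `S(m,n;c)`. -/
noncomputable def klooOrd (c : ℕ) [NeZero c] (m n : ZMod c) : ℂ :=
  ∑ x : (ZMod c)ˣ, eZMod c (m * (x : ZMod c) + n * ((x⁻¹ : (ZMod c)ˣ) : ZMod c))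

/-- `S_{χ̄²}(m,n;c) = ∑_{x mod c, (x,c)=1} χ(x)² e_c(mx + n x̄)`, where `χ` is a character
modulo `q` with `q ∣ c` and is evaluated at `x mod q`. -/
noncomputable def SChiSq (q c : ℕ) [NeZero c] (h : q ∣ c) (χ : DirichletCharacter ℂ q)
    (m n : ZMod c) : ℂ :=
  ∑ x : (ZMod c)ˣ, (χ (ZMod.castHom h (ZMod q) (x : ZMod c)))^2 *
    eZMod c (m * (x : ZMod c) + n * ((x⁻¹ : (ZMod c)ˣ) : ZMod c))

/-- The coset sum `σ_{ψ,ε}(m,n;c)`: the sum over the Dirichlet characters `χ` modulo `p^k`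
in the coset `ψ·Ĝ_{p^j}` of `χ(m)·conj(χ(n))·(1 + ε·χ(-1))·S_{χ̄²}(m,n;c)`. -/
noncomputable def cosetSum (p k j : ℕ) (hjk : j ≤ k) (ψ : DirichletCharacter ℂ (p^k))
    (ε : ℤ) (c : ℕ) [NeZero c] (hqc : p^k ∣ c) (m n : ZMod c) : ℂ :=
  ∑ χ' : DirichletCharacter ℂ (p^j),
    (ψ * DirichletCharacter.changeLevel (pow_dvd_pow p hjk) χ')
        (ZMod.castHom hqc (ZMod (p^k)) m) *
    (starRingEnd ℂ) ((ψ * DirichletCharacter.changeLevel (pow_dvd_pow p hjk) χ')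
        (ZMod.castHom hqc (ZMod (p^k)) n)) *
    (1 + (ε : ℂ) * (ψ * DirichletCharacter.changeLevel (pow_dvd_pow p hjk) χ') (-1)) *
    SChiSq (p^k) c hqc (ψ * DirichletCharacter.changeLevel (pow_dvd_pow p hjk) χ') m n

/-- The sums `K_ψ^±(m,n;p^r)` (the sign `±` is the parameter `s`): the sum of
`ψ(x)² e_{p^r}(mx + n x̄)` over `x mod p^r`, `p ∤ x`, with `m x² ≡ s·n (mod p^j)`. -/
noncomputable def Kpm (p k j r : ℕ) [NeZero (p^r)] (hkr : k ≤ r) (hjr : j ≤ r)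
    (ψ : DirichletCharacter ℂ (p^k)) (s : ℤ) (m n : ZMod (p^r)) : ℂ :=
  ∑ x ∈ Finset.univ.filter (fun x : (ZMod (p^r))ˣ =>
      ZMod.castHom (pow_dvd_pow p hjr) (ZMod (p^j)) (m * (x : ZMod (p^r))^2)
        = (s : ZMod (p^j)) * ZMod.castHom (pow_dvd_pow p hjr) (ZMod (p^j)) n),
    (ψ (ZMod.castHom (pow_dvd_pow p hkr) (ZMod (p^k)) (x : ZMod (p^r))))^2 *
      eZMod (p^r) (m * (x : ZMod (p^r)) + n * ((x⁻¹ : (ZMod (p^r))ˣ) : ZMod (p^r)))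

lemma eZMod_eq_stdAddChar (c : ℕ) [NeZero c] (z : ZMod c) :
    eZMod c z = ZMod.stdAddChar z := by
  rw [ZMod.stdAddChar_apply, ZMod.toCircle_apply, eZMod]

/-- The unit `1 + a` for an element `a` with `a * a = 0`. -/
def unitOneAdd {R : Type*} [CommRing R] (a : R) (h : a * a = 0) : Rˣ where
  val := 1 + a
  inv := 1 - a
  val_inv := by linear_combination -h
  inv_val := by linear_combination -h

/-- Averaging over the substitutions `x ↦ x * (1 + d * u)` with `d * d = 0` kills the
contribution of every `x` with `d * (m * x - n * x⁻¹) ≠ 0`. -/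
lemma sum_mul_eZMod_eq_zero (c : ℕ) [NeZero c] (d m n : ZMod c) (hd : d * d = 0)
    (F : (ZMod c)ˣ → ℂ)
    (hF : ∀ x y : (ZMod c)ˣ, d ∣ (y : ZMod c) - 1 → F (x * y) = F x)
    (h0 : ∀ x : (ZMod c)ˣ, d * (m * x - n * (x⁻¹ : (ZMod c)ˣ)) = 0 → F x = 0) :
    ∑ x : (ZMod c)ˣ, F x * eZMod c (m * x + n * (x⁻¹ : (ZMod c)ˣ)) = 0 := by
  simp only [eZMod_eq_stdAddChar]
  have key (u : ZMod c) :
      ∑ x : (ZMod c)ˣ, F x * ZMod.stdAddChar (m * (x : ZMod c) + n * ((x⁻¹ : (ZMod c)ˣ) : ZMod c)) =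
        ∑ x : (ZMod c)ˣ, F x * ZMod.stdAddChar (m * (x : ZMod c) + n * ((x⁻¹ : (ZMod c)ˣ) : ZMod c)) *
          ZMod.stdAddChar (u * (d * (m * (x : ZMod c) - n * ((x⁻¹ : (ZMod c)ˣ) : ZMod c)))) := by
    have hdu : d * u * (d * u) = 0 := by linear_combination u ^ 2 * hd
    rw [← Equiv.sum_comp (Equiv.mulRight (unitOneAdd (d * u) hdu))]
    refine Finset.sum_congr rfl fun x _ => ?_
    have hv : ((unitOneAdd (d * u) hdu : (ZMod c)ˣ) : ZMod c) = 1 + d * u := rfl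
    have hi : (((unitOneAdd (d * u) hdu)⁻¹ : (ZMod c)ˣ) : ZMod c) = 1 - d * u := rfl
    rw [Equiv.coe_mulRight, hF x _ ⟨u, by rw [hv]; ring⟩, mul_assoc, ← AddChar.map_add_eq_mul]
    congr 2
    rw [mul_inv, Units.val_mul, Units.val_mul, hv, hi]
    ring
  have hsum : (c : ℂ) *
      ∑ x : (ZMod c)ˣ, F x * ZMod.stdAddChar (m * (x : ZMod c) + n * ((x⁻¹ : (ZMod c)ˣ) : ZMod c)) = 0 := by
    calc _ = ∑ _u : ZMod c,
          ∑ x : (ZMod c)ˣ, F x * ZMod.stdAddChar (m * (x : ZMod c) + n * ((x⁻¹ : (ZMod c)ˣ) : ZMod c)) := by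
          simp [ZMod.card]
      _ = _ := by
        rw [Finset.sum_congr rfl fun u _ => key u, Finset.sum_comm]
        refine Finset.sum_eq_zero fun x _ => ?_
        rw [← Finset.mul_sum, AddChar.sum_mulShift _ (ZMod.isPrimitive_stdAddChar c)]
        split_ifs with h
        · rw [h0 x h, zero_mul, zero_mul]
        · simp
  exact (mul_eq_zero.mp hsum).resolve_left (NeZero.ne _)

/-- If `F` is constant along the substitutions `x ↦ x * (1 + d * u)` and equals `K` at the
stationary points, then twisting a Kloosterman sum by `F` multiplies it by `K`. -/
lemma sum_mul_eZMod_eq_mul_klooOrd (c : ℕ) [NeZero c] (d m n : ZMod c) (hd : d * d = 0)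
    (F : (ZMod c)ˣ → ℂ) (K : ℂ)
    (hF : ∀ x y : (ZMod c)ˣ, d ∣ (y : ZMod c) - 1 → F (x * y) = F x)
    (hK : ∀ x : (ZMod c)ˣ, d * (m * x - n * (x⁻¹ : (ZMod c)ˣ)) = 0 → F x = K) :
    ∑ x : (ZMod c)ˣ, F x * eZMod c (m * x + n * (x⁻¹ : (ZMod c)ˣ)) = K * klooOrd c m n := by
  have h := sum_mul_eZMod_eq_zero c d m n hd (fun x => F x - K)
    (fun x y hy => by rw [hF x y hy]) (fun x hx => by rw [hK x hx, sub_self])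
  simp only [sub_mul, Finset.sum_sub_distrib, ← Finset.mul_sum] at h
  exact sub_eq_zero.mp h

lemma castHom_eq_zero_of_natCast_mul_eq_zero {c q d : ℕ} [NeZero c] (hqc : q ∣ c)
    (hc : c = d * q) (z : ZMod c) (h : (d : ZMod c) * z = 0) :
    ZMod.castHom hqc (ZMod q) z = 0 := by
  have hd : 0 < d := Nat.pos_of_ne_zero fun h => NeZero.ne c (by rw [hc, h, zero_mul])
  obtain ⟨a, rfl⟩ := ZMod.natCast_zmod_surjective z
  rw [map_natCast, ZMod.natCast_eq_zero_iff]
  rw [← Nat.cast_mul, ZMod.natCast_eq_zero_iff] at h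
  exact Nat.dvd_of_mul_dvd_mul_left hd (hc ▸ h)

lemma changeLevel_neg_one {a q : ℕ} (h : a ∣ q) (χ : DirichletCharacter ℂ a) :
    DirichletCharacter.changeLevel h χ (-1) = χ (-1) := by
  have := DirichletCharacter.changeLevel_eq_cast_of_dvd χ h (-1)
  rwa [Units.val_neg, Units.val_one, ZMod.cast_neg h, ZMod.cast_one h] at this

/-- The sum of `1 + w * χ(-1)` over the Dirichlet characters modulo `N > 2`. -/
lemma sum_one_add_mul_neg_one (N : ℕ) (hN : 2 < N) (w : ℂ) :
    ∑ χ : DirichletCharacter ℂ N, (1 + w * χ (-1)) = (Nat.totient N : ℂ) := by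
  have : NeZero N := ⟨by omega⟩
  have : Fact (2 < N) := ⟨hN⟩
  rw [Finset.sum_add_distrib, ← Finset.mul_sum,
    DirichletCharacter.sum_characters_eq_zero ℂ (ZMod.neg_one_ne_one (n := N)), mul_zero, add_zero,
    Finset.sum_const, nsmul_one, Finset.card_univ, ← Nat.card_eq_fintype_card,
    DirichletCharacter.card_eq_totient_of_hasEnoughRootsOfUnity]

lemma DirichletCharacter.mul_conj_mul_sq_eq_one {q : ℕ} (χ : DirichletCharacter ℂ q)
    {M N : ZMod q} (hN : IsUnit N) (X : (ZMod q)ˣ) (h : M * X = N * (X⁻¹ : (ZMod q)ˣ)) :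
    χ M * (starRingEnd ℂ) (χ N) * χ X ^ 2 = 1 := by
  have hM : M * X ^ 2 = N := by rw [pow_two, ← mul_assoc, h, mul_assoc, Units.inv_mul, mul_one]
  have hχ : χ M * χ X ^ 2 = χ N := by rw [← map_pow, ← map_mul, hM]
  obtain ⟨N, rfl⟩ := hN
  rw [mul_right_comm, hχ, Complex.mul_conj, Complex.normSq_eq_norm_sq, χ.unit_norm_eq_one]
  simp

/-- for `c = b·p^r` with `r ≥ 2k`, the coset sum collapses to
`φ(p^j)` times the ordinary Kloosterman sum. -/
theorem cosetSum_eq_totient_mul_klooOrd (p : ℕ) (hp : p.Prime) (hodd : Odd p)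
    (k : ℕ) (hk : 2 ≤ k) (j : ℕ) (hj : 1 ≤ j) (hjk : j < k)
    (ψ : DirichletCharacter ℂ (p^k)) (hψ : (ψ^2).conductor = p^k)
    (ε : ℤ) (hε : ε = 1 ∨ ε = -1)
    (b m n : ℕ) (hb : 0 < b) (hm : 0 < m) (hn : 0 < n)
    (hpb : ¬ p ∣ b) (hpm : ¬ p ∣ m) (hpn : ¬ p ∣ n)
    (r : ℕ) (hr : 2 * k ≤ r) (c : ℕ) [NeZero c] (hc : c = b * p ^ r)
    (hqc : p ^ k ∣ c) :
    cosetSum p k j hjk.le ψ ε c hqc (m : ZMod c) (n : ZMod c)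
      = (Nat.totient (p^j) : ℂ) * klooOrd c (m : ZMod c) (n : ZMod c) := by
  have hk0 : p ^ k ≠ 0 := pow_ne_zero _ hp.ne_zero
  set d : ℕ := b * p ^ (r - k) with hd
  have hcd : c = d * p ^ k := by
    rw [hc, hd, mul_assoc, ← pow_add, Nat.sub_add_cancel (by omega)]
  have hqd : p ^ k ∣ d := (pow_dvd_pow p (by omega)).mul_left b
  have hdd : (d : ZMod c) * d = 0 := by
    rw [← Nat.cast_mul, ZMod.natCast_eq_zero_iff]
    nth_rewrite 1 [hcd]
    exact Nat.mul_dvd_mul_left d hqd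
  have hpj : 2 < p ^ j := by
    have h3 : 3 ≤ p := by
      rcases hodd with ⟨t, rfl⟩
      have := hp.two_le
      omega
    exact lt_of_lt_of_le (by omega) (Nat.le_self_pow (by omega) p)
  have hnu : IsUnit (ZMod.castHom hqc (ZMod (p ^ k)) (n : ZMod c)) := by
    rw [map_natCast, ZMod.isUnit_iff_coprime]
    exact ((hp.coprime_iff_not_dvd.mpr hpn).pow_left k).symm
  simp only [cosetSum, SChiSq, Finset.mul_sum, ← mul_assoc]
  rw [Finset.sum_comm]
  simp only [← Finset.sum_mul]
  refine sum_mul_eZMod_eq_mul_klooOrd c d m n hdd _ _ (fun x y hy => ?_) (fun x hx => ?_)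
  · have hy1 : ZMod.castHom hqc (ZMod (p ^ k)) (y : ZMod c) = 1 := by
      obtain ⟨u, hu⟩ := hy
      rw [sub_eq_iff_eq_add.mp hu, map_add, map_mul, map_natCast,
        (ZMod.natCast_eq_zero_iff d (p ^ k)).mpr hqd, zero_mul, zero_add, map_one]
    simp only [Units.val_mul, map_mul, hy1, mul_one]
  · have hz := castHom_eq_zero_of_natCast_mul_eq_zero hqc hcd _ hx
    rw [map_sub, map_mul, map_mul, sub_eq_zero] at hz
    rw [← sum_one_add_mul_neg_one (p ^ j) hpj (ε * ψ (-1))]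
    refine Finset.sum_congr rfl fun χ' _ => ?_
    have h1 := DirichletCharacter.mul_conj_mul_sq_eq_one
      (ψ * DirichletCharacter.changeLevel (pow_dvd_pow p hjk.le) χ') hnu
      (Units.map (ZMod.castHom hqc (ZMod (p ^ k))).toMonoidHom x) hz
    rw [mul_right_comm]
    refine (congrArg (· * _) h1).trans ?_
    rw [one_mul, MulChar.mul_apply, changeLevel_neg_one, mul_assoc]
end

section
/- If b, m, n are positive integers not divisible by p, and c = b·p^r where r ≥ k, then σ_{ψ,ε}(m,n;c) = ψ(m)·conj(ψ(n))·φ(p^j)·S(p̄^r m, p̄^r n; b)·[K_ψ^+(b̄m, b̄n; p^r) + ε·ψ(−1)·K_ψ^−(b̄m, b̄n; p^r)], where p̄ denotes the multiplicative inverse of p modulo b and b̄ denotes the multiplicative inverse of b modulo p^r. -/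
open Complex Finset

lemma eZMod_intCast (c : ℕ) [NeZero c] (a : ℤ) :
    eZMod c (a : ZMod c) = Complex.exp (2 * Real.pi * Complex.I * a / c) := by
  rw [eZMod_eq_stdAddChar, ZMod.stdAddChar_coe]

/-- The twisted multiplicativity `e_{bQ}(z) = e_b(Q̄ z) e_Q(b̄ z)` for coprime `b` and `Q`. -/
lemma eZMod_mul_of_coprime (b Q : ℕ) [NeZero b] [NeZero Q] [NeZero (b * Q)]
    (h : b.Coprime Q) (z : ZMod (b * Q)) :
    eZMod (b * Q) z =
      eZMod b ((Q : ZMod b)⁻¹ * ZMod.castHom (Dvd.intro Q rfl) (ZMod b) z) *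
        eZMod Q ((b : ZMod Q)⁻¹ * ZMod.castHom (Dvd.intro_left b rfl) (ZMod Q) z) := by
  obtain ⟨a, rfl⟩ := ZMod.intCast_surjective z
  obtain ⟨u, hu⟩ := ZMod.intCast_surjective ((Q : ZMod b)⁻¹)
  obtain ⟨v, hv⟩ := ZMod.intCast_surjective ((b : ZMod Q)⁻¹)
  have hub : (b : ℤ) ∣ 1 - (u * Q + v * b) := by
    rw [← ZMod.intCast_zmod_eq_zero_iff_dvd]
    push_cast
    rw [hu, mul_comm _ (Q : ZMod b), ZMod.coe_mul_inv_eq_one _ h.symm]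
    simp
  have hvQ : (Q : ℤ) ∣ 1 - (u * Q + v * b) := by
    rw [← ZMod.intCast_zmod_eq_zero_iff_dvd]
    push_cast
    rw [hv, mul_comm _ (b : ZMod Q), ZMod.coe_mul_inv_eq_one _ h]
    simp
  have hdvd : ((b * Q : ℕ) : ℤ) ∣ 1 - (u * Q + v * b) := by
    push_cast
    exact IsCoprime.mul_dvd (Nat.isCoprime_iff_coprime.mpr h) hub hvQ
  have hcong : (a : ZMod (b * Q)) = (((u * Q + v * b) * a : ℤ) : ZMod (b * Q)) := by
    rw [← sub_eq_zero, ← Int.cast_sub, ZMod.intCast_zmod_eq_zero_iff_dvd]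
    obtain ⟨t, ht⟩ := hdvd
    exact ⟨t * a, by linear_combination a * ht⟩
  have hb : (b : ℂ) ≠ 0 := NeZero.ne _
  have hQ : (Q : ℂ) ≠ 0 := NeZero.ne _
  rw [hcong, eZMod_intCast, ← hcong, map_intCast, map_intCast, ← hu, ← hv, ← Int.cast_mul,
    ← Int.cast_mul, eZMod_intCast, eZMod_intCast, ← Complex.exp_add]
  congr 1
  push_cast
  field_simp

/-- The Chinese remainder theorem for unit groups of `ZMod`. -/
noncomputable def unitsChineseRemainder {b Q : ℕ} (h : b.Coprime Q) :
    (ZMod (b * Q))ˣ ≃* (ZMod b)ˣ × (ZMod Q)ˣ :=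
  (Units.mapEquiv (ZMod.chineseRemainder h).toMulEquiv).trans MulEquiv.prodUnits

lemma coe_unitsChineseRemainder_fst {b Q : ℕ} (h : b.Coprime Q) (x : (ZMod (b * Q))ˣ) :
    ((unitsChineseRemainder h x).1 : ZMod b) =
      ZMod.castHom (Dvd.intro Q rfl) (ZMod b) (x : ZMod (b * Q)) :=
  RingHom.congr_fun (Subsingleton.elim
    ((RingHom.fst (ZMod b) (ZMod Q)).comp (ZMod.chineseRemainder h).toRingHom) _) _

lemma coe_unitsChineseRemainder_snd {b Q : ℕ} (h : b.Coprime Q) (x : (ZMod (b * Q))ˣ) :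
    ((unitsChineseRemainder h x).2 : ZMod Q) =
      ZMod.castHom (Dvd.intro_left b rfl) (ZMod Q) (x : ZMod (b * Q)) :=
  RingHom.congr_fun (Subsingleton.elim
    ((RingHom.snd (ZMod b) (ZMod Q)).comp (ZMod.chineseRemainder h).toRingHom) _) _

/-- Twisted multiplicativity of the Kloosterman sums attached to a character modulo `q ∣ Q`. -/
lemma SChiSq_mul_of_coprime (q b Q : ℕ) [NeZero b] [NeZero Q] [NeZero (b * Q)]
    (h : b.Coprime Q) (hqQ : q ∣ Q) (hq : q ∣ b * Q) (χ : DirichletCharacter ℂ q)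
    (m n : ZMod (b * Q)) :
    SChiSq q (b * Q) hq χ m n =
      klooOrd b ((Q : ZMod b)⁻¹ * ZMod.castHom (Dvd.intro Q rfl) (ZMod b) m)
          ((Q : ZMod b)⁻¹ * ZMod.castHom (Dvd.intro Q rfl) (ZMod b) n) *
        SChiSq q Q hqQ χ
          ((b : ZMod Q)⁻¹ * ZMod.castHom (Dvd.intro_left b rfl) (ZMod Q) m)
          ((b : ZMod Q)⁻¹ * ZMod.castHom (Dvd.intro_left b rfl) (ZMod Q) n) := by
  simp only [SChiSq, klooOrd]
  rw [Finset.sum_mul_sum, ← Fintype.sum_prod_type']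
  refine Fintype.sum_equiv (unitsChineseRemainder h).toEquiv _ _ fun x ↦ ?_
  have hcomp : ZMod.castHom hq (ZMod q) (x : ZMod (b * Q)) =
      ZMod.castHom hqQ (ZMod q)
        (ZMod.castHom (Dvd.intro_left b rfl) (ZMod Q) (x : ZMod (b * Q))) :=
    RingHom.congr_fun (Subsingleton.elim _ ((ZMod.castHom hqQ (ZMod q)).comp
      (ZMod.castHom (Dvd.intro_left b rfl) (ZMod Q)))) _
  simp only [MulEquiv.toEquiv_eq_coe, MulEquiv.coe_toEquiv, ← Prod.fst_inv, ← Prod.snd_inv,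
    ← map_inv, coe_unitsChineseRemainder_fst, coe_unitsChineseRemainder_snd]
  rw [eZMod_mul_of_coprime b Q h, hcomp]
  simp only [map_add, map_mul, mul_add, mul_assoc]
  ring

/-- Orthogonality over the coset of `ψ` by the characters modulo `d ∣ q`. -/
lemma sum_coset_apply_unit {d q : ℕ} [NeZero d] (h : d ∣ q) (ψ : DirichletCharacter ℂ q)
    (u : (ZMod q)ˣ) :
    ∑ χ : DirichletCharacter ℂ d, (ψ * DirichletCharacter.changeLevel h χ) u =
      if ZMod.castHom h (ZMod d) u = 1 then ψ u * d.totient else 0 := by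
  simp only [MulChar.coeToFun_mul, Pi.mul_apply, DirichletCharacter.changeLevel_eq_cast_of_dvd,
    ← Finset.mul_sum, DirichletCharacter.sum_characters_eq, ZMod.castHom_apply, mul_ite, mul_zero]
  congr

lemma conj_apply_unit {q : ℕ} (χ : DirichletCharacter ℂ q) (u : (ZMod q)ˣ) :
    (starRingEnd ℂ) (χ u) = χ ((u⁻¹ : (ZMod q)ˣ) : ZMod q) := by
  rw [starRingEnd_apply, MulChar.star_apply', MulChar.inv_apply, Ring.inverse_unit]

/-- The sum over the coset of `ψ` of the weights `χ(m) conj(χ(n)) (1 + ε χ(-1)) χ(x)²`. -/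
lemma sum_coset_weight {d q : ℕ} [NeZero d] (h : d ∣ q) (ψ : DirichletCharacter ℂ q)
    (ε : ℂ) (m n x : (ZMod q)ˣ) :
    ∑ χ : DirichletCharacter ℂ d,
        (ψ * DirichletCharacter.changeLevel h χ) m *
        (starRingEnd ℂ) ((ψ * DirichletCharacter.changeLevel h χ) n) *
        (1 + ε * (ψ * DirichletCharacter.changeLevel h χ) (-1)) *
        (ψ * DirichletCharacter.changeLevel h χ) x ^ 2 =
      ψ m * (starRingEnd ℂ) (ψ n) * d.totient *
        ((if ZMod.castHom h (ZMod d) ((m : ZMod q) * (x : ZMod q) ^ 2) =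
            ZMod.castHom h (ZMod d) n then ψ x ^ 2 else 0) +
          ε * ψ (-1) * (if ZMod.castHom h (ZMod d) ((m : ZMod q) * (x : ZMod q) ^ 2) =
            -ZMod.castHom h (ZMod d) n then ψ x ^ 2 else 0)) := by
  have key (χ : DirichletCharacter ℂ q) :
      χ m * (starRingEnd ℂ) (χ n) * (1 + ε * χ (-1)) * χ x ^ 2 =
        χ (m * n⁻¹ * x ^ 2 : (ZMod q)ˣ) + ε * χ (-(m * n⁻¹ * x ^ 2) : (ZMod q)ˣ) := by
    rw [conj_apply_unit, ← neg_one_mul (m * n⁻¹ * x ^ 2)]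
    simp only [Units.val_mul, Units.val_pow_eq_pow_val, map_mul, map_pow, Units.val_neg,
      Units.val_one]
    ring
  have hiff (s : ZMod d) (hs : s * s = 1) :
      s * ZMod.castHom h (ZMod d) ((m * n⁻¹ * x ^ 2 : (ZMod q)ˣ) : ZMod q) = 1 ↔
        ZMod.castHom h (ZMod d) ((m : ZMod q) * (x : ZMod q) ^ 2) =
          s * ZMod.castHom h (ZMod d) n := by
    have hn : ZMod.castHom h (ZMod d) ((n⁻¹ : (ZMod q)ˣ) : ZMod q) *
        ZMod.castHom h (ZMod d) n = 1 := by
      rw [← map_mul, Units.inv_mul, map_one]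
    simp only [Units.val_mul, Units.val_pow_eq_pow_val, map_mul, map_pow]
    constructor <;> intro H
    · linear_combination (s * ZMod.castHom h (ZMod d) n) * H -
        ZMod.castHom h (ZMod d) m * ZMod.castHom h (ZMod d) x ^ 2 * hs -
        s * s * ZMod.castHom h (ZMod d) m * ZMod.castHom h (ZMod d) x ^ 2 * hn
    · linear_combination (s * ZMod.castHom h (ZMod d) ((n⁻¹ : (ZMod q)ˣ) : ZMod q)) * H +
        ZMod.castHom h (ZMod d) ((n⁻¹ : (ZMod q)ˣ) : ZMod q) * ZMod.castHom h (ZMod d) n * hs + hn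
  have h1 := hiff 1 (by ring)
  have h2 := hiff (-1) (by ring)
  rw [one_mul, one_mul] at h1
  rw [neg_one_mul, neg_one_mul] at h2
  simp only [key, Finset.sum_add_distrib, ← Finset.mul_sum, sum_coset_apply_unit]
  simp only [h1, Units.val_neg, map_neg, h2]
  rw [conj_apply_unit, ← Units.val_neg, ← neg_one_mul (m * n⁻¹ * x ^ 2)]
  simp only [Units.val_mul, Units.val_pow_eq_pow_val, map_mul, map_pow, Units.val_neg,
      Units.val_one]
  split_ifs <;> ring

/-- `Kpm` as a sum over all units, with the congruence condition cleared of the unit `u`. -/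
lemma Kpm_unit_mul (p k j r : ℕ) [NeZero (p ^ r)] (hkr : k ≤ r) (hjr : j ≤ r) (hjk : j ≤ k)
    (ψ : DirichletCharacter ℂ (p ^ k)) (s : ℤ) (u : (ZMod (p ^ r))ˣ) (m n : ℕ) :
    Kpm p k j r hkr hjr ψ s (u * m) (u * n) =
      ∑ x : (ZMod (p ^ r))ˣ,
        (if ZMod.castHom (pow_dvd_pow p hjk) (ZMod (p ^ j)) ((m : ZMod (p ^ k)) *
            ZMod.castHom (pow_dvd_pow p hkr) (ZMod (p ^ k)) (x : ZMod (p ^ r)) ^ 2) =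
            s * ZMod.castHom (pow_dvd_pow p hjk) (ZMod (p ^ j)) (n : ZMod (p ^ k))
          then ψ (ZMod.castHom (pow_dvd_pow p hkr) (ZMod (p ^ k)) (x : ZMod (p ^ r))) ^ 2
          else 0) *
        eZMod (p ^ r) (u * m * (x : ZMod (p ^ r)) +
          u * n * ((x⁻¹ : (ZMod (p ^ r))ˣ) : ZMod (p ^ r))) := by
  rw [Kpm, Finset.sum_filter]
  refine Finset.sum_congr rfl fun x _ ↦ ?_
  have hcomp : ZMod.castHom (pow_dvd_pow p hjr) (ZMod (p ^ j)) (x : ZMod (p ^ r)) =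
      ZMod.castHom (pow_dvd_pow p hjk) (ZMod (p ^ j))
        (ZMod.castHom (pow_dvd_pow p hkr) (ZMod (p ^ k)) (x : ZMod (p ^ r))) :=
    RingHom.congr_fun (Subsingleton.elim _ ((ZMod.castHom (pow_dvd_pow p hjk) (ZMod (p ^ j))).comp
      (ZMod.castHom (pow_dvd_pow p hkr) (ZMod (p ^ k))))) _
  have hu : IsUnit (ZMod.castHom (pow_dvd_pow p hjr) (ZMod (p ^ j)) (u : ZMod (p ^ r))) :=
    u.isUnit.map _
  have hiff : ZMod.castHom (pow_dvd_pow p hjr) (ZMod (p ^ j))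
        (u * (m : ZMod (p ^ r)) * (x : ZMod (p ^ r)) ^ 2) =
        s * ZMod.castHom (pow_dvd_pow p hjr) (ZMod (p ^ j)) (u * (n : ZMod (p ^ r))) ↔
      ZMod.castHom (pow_dvd_pow p hjk) (ZMod (p ^ j)) ((m : ZMod (p ^ k)) *
        ZMod.castHom (pow_dvd_pow p hkr) (ZMod (p ^ k)) (x : ZMod (p ^ r)) ^ 2) =
        s * ZMod.castHom (pow_dvd_pow p hjk) (ZMod (p ^ j)) (n : ZMod (p ^ k)) := by
    simp only [map_mul, map_pow, map_natCast, hcomp]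
    rw [mul_assoc, mul_left_comm (s : ZMod (p ^ j)), hu.mul_right_inj]
  simp only [hiff, ite_mul, zero_mul]

/-- factorization of the coset sum into an ordinary Kloosterman sum modulo `b`
and the same-sign/opposite-sign sums `K_ψ^±` modulo `p^r`, for `c = b·p^r` with `r ≥ k`. -/
theorem cosetSum_factorization (p : ℕ) (hp : p.Prime) (hodd : Odd p)
    (k : ℕ) (hk : 2 ≤ k) (j : ℕ) (hj : 1 ≤ j) (hjk : j < k)
    (ψ : DirichletCharacter ℂ (p^k)) (hψ : (ψ^2).conductor = p^k)
    (ε : ℤ) (hε : ε = 1 ∨ ε = -1)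
    (b m n : ℕ) (hb : 0 < b) (hm : 0 < m) (hn : 0 < n)
    (hpb : ¬ p ∣ b) (hpm : ¬ p ∣ m) (hpn : ¬ p ∣ n)
    (r : ℕ) (hkr : k ≤ r) (c : ℕ) [NeZero c] [NeZero b] [NeZero (p^r)]
    (hc : c = b * p ^ r) (hqc : p ^ k ∣ c) :
    cosetSum p k j hjk.le ψ ε c hqc (m : ZMod c) (n : ZMod c)
      = ψ (m : ZMod (p^k)) * (starRingEnd ℂ) (ψ (n : ZMod (p^k))) *
          (Nat.totient (p^j) : ℂ) *
          klooOrd b (((p : ZMod b)⁻¹)^r * (m : ZMod b)) (((p : ZMod b)⁻¹)^r * (n : ZMod b)) *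
          (Kpm p k j r hkr (le_of_lt (lt_of_lt_of_le hjk hkr)) ψ 1
              ((b : ZMod (p^r))⁻¹ * (m : ZMod (p^r))) ((b : ZMod (p^r))⁻¹ * (n : ZMod (p^r)))
            + (ε : ℂ) * ψ (-1) *
              Kpm p k j r hkr (le_of_lt (lt_of_lt_of_le hjk hkr)) ψ (-1)
                ((b : ZMod (p^r))⁻¹ * (m : ZMod (p^r)))
                ((b : ZMod (p^r))⁻¹ * (n : ZMod (p^r)))) := by
  subst hc
  have hcop (a i : ℕ) (ha : ¬ p ∣ a) : a.Coprime (p ^ i) :=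
    ((hp.coprime_iff_not_dvd.mpr ha).pow_left i).symm
  have : NeZero (p ^ j) := ⟨pow_ne_zero _ hp.ne_zero⟩
  have hinv : ((p : ZMod b)⁻¹) ^ r = ((p ^ r : ℕ) : ZMod b)⁻¹ := by
    have hpu : (p : ZMod b) * (p : ZMod b)⁻¹ = 1 :=
      ZMod.coe_mul_inv_eq_one _ (hp.coprime_iff_not_dvd.mpr hpb)
    have hpr : ((p ^ r : ℕ) : ZMod b) * ((p ^ r : ℕ) : ZMod b)⁻¹ = 1 :=
      ZMod.coe_mul_inv_eq_one _ (hcop b r hpb).symm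
    have hpow : ((p ^ r : ℕ) : ZMod b) * ((p : ZMod b)⁻¹) ^ r = 1 := by
      rw [Nat.cast_pow, ← mul_pow, hpu, one_pow]
    exact left_inv_eq_right_inv (by rw [mul_comm, hpow]) hpr
  obtain ⟨u, hu⟩ : ∃ u : (ZMod (p ^ r))ˣ, (u : ZMod (p ^ r)) = (b : ZMod (p ^ r))⁻¹ :=
    ⟨(ZMod.unitOfCoprime b (hcop b r hpb))⁻¹, rfl⟩
  have hK (s : ℤ) := Kpm_unit_mul p k j r hkr (le_of_lt (lt_of_lt_of_le hjk hkr)) hjk.le ψ s u m n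
  have hweight (x : (ZMod (p ^ r))ˣ) := sum_coset_weight (pow_dvd_pow p hjk.le) ψ ε
    (ZMod.unitOfCoprime m (hcop m k hpm)) (ZMod.unitOfCoprime n (hcop n k hpn))
    (Units.map (ZMod.castHom (pow_dvd_pow p hkr) (ZMod (p ^ k)) : _ →* _) x)
  simp only [ZMod.coe_unitOfCoprime, Units.coe_map, MonoidHom.coe_coe,
    map_natCast] at hweight
  simp only [cosetSum, SChiSq_mul_of_coprime _ b (p ^ r) (hcop b r hpb) (pow_dvd_pow p hkr) hqc,
    map_natCast, hinv, ← hu, hK]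
  generalize klooOrd b _ _ = S
  simp only [SChiSq, Finset.mul_sum]
  rw [Finset.sum_comm, ← Finset.sum_add_distrib, Finset.mul_sum]
  refine Finset.sum_congr rfl fun x _ ↦ ?_
  simp only [Int.cast_one, Int.cast_neg, one_mul, neg_one_mul]
  generalize eZMod (p ^ r) _ = e
  refine Eq.trans ?_ ((congrArg (S * e * ·) (hweight x)).trans (by ring))
  rw [Finset.mul_sum]
  exact Finset.sum_congr rfl fun χ _ ↦ by ring
end

section
/- For every ε > 0 there exists a constant C = C(ε) > 0 such that the following holds: for all positive integers A ≤ B, every positive integer c, and every choice of an integer a_p for each prime p dividing c, one has ∑_{A ≤ r ≤ B} τ(r) · gcd(∏_{p | c, p prime} p^{ν_p(a_p² + 4r)}, flrt(c)) ≤ C · B^ε · c^ε · (B − A + c^{1/2}). -/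
open Finset

/-- The floor square root `flrt(n) = ∏_{p ∣ n} p^{⌊ν_p(n)/2⌋}`. -/
def flrt (n : ℕ) : ℕ := ∏ p ∈ n.primeFactors, p ^ (n.factorization p / 2)

/-- The key local estimate behind the divisor bound. -/
lemma natCast_add_one_le_mul_rpow {ε : ℝ} (hε : 0 < ε) {x : ℝ} (hx : 2 ≤ x) (k : ℕ) :
    (k : ℝ) + 1 ≤ (1 + 1 / (ε * Real.log 2)) * (x ^ k) ^ ε := by
  have hlog : 0 < Real.log 2 := Real.log_pos one_lt_two
  have hk : (0 : ℝ) ≤ k := k.cast_nonneg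
  have hx' : 0 < x := by linarith
  have hexp : 1 + k * (ε * Real.log 2) ≤ (x ^ k) ^ ε := by
    rw [Real.rpow_def_of_pos (pow_pos hx' k), Real.log_pow]
    have h := Real.add_one_le_exp (k * Real.log x * ε)
    have hmono : k * (ε * Real.log 2) ≤ k * Real.log x * ε := by
      have : Real.log 2 ≤ Real.log x := Real.log_le_log two_pos hx
      calc k * (ε * Real.log 2) = k * Real.log 2 * ε := by ring
        _ ≤ k * Real.log x * ε := by gcongr
    linarith
  have hpos : 0 < ε * Real.log 2 := mul_pos hε hlog
  calc (k : ℝ) + 1 ≤ (1 + 1 / (ε * Real.log 2)) * (1 + k * (ε * Real.log 2)) := by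
        have hexpand : (1 + 1 / (ε * Real.log 2)) * (1 + k * (ε * Real.log 2))
            = k + 1 + (k * (ε * Real.log 2) + 1 / (ε * Real.log 2)) := by
          field_simp
          ring
        rw [hexpand]
        have : 0 ≤ k * (ε * Real.log 2) + 1 / (ε * Real.log 2) := by positivity
        linarith
    _ ≤ _ := by gcongr

/-- For primes beyond `2 ^ (1 / ε)` the local estimate holds with constant `1`. -/
lemma natCast_add_one_le_rpow {ε : ℝ} (hε : 0 < ε) {x : ℝ} (hx : (2 : ℝ) ^ (1 / ε) ≤ x) (k : ℕ) :
    (k : ℝ) + 1 ≤ (x ^ k) ^ ε := by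
  have hx0 : 0 ≤ x := le_trans (by positivity) hx
  have htwo : (2 : ℝ) ≤ x ^ ε := by
    calc (2 : ℝ) = ((2 : ℝ) ^ (1 / ε)) ^ ε := by
          rw [← Real.rpow_mul zero_le_two, one_div_mul_cancel hε.ne', Real.rpow_one]
      _ ≤ x ^ ε := by gcongr
  have hpow : (x ^ k) ^ ε = (x ^ ε) ^ k := by
    rw [← Real.rpow_natCast, ← Real.rpow_natCast, ← Real.rpow_mul hx0, ← Real.rpow_mul hx0,
      mul_comm]
  rw [hpow]
  calc (k : ℝ) + 1 ≤ 2 ^ k := by exact_mod_cast Nat.lt_two_pow_self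
    _ ≤ _ := by gcongr

/-- The divisor bound: `τ(n) ≤ C n ^ ε`. -/
theorem exists_card_divisors_le_rpow {ε : ℝ} (hε : 0 < ε) :
    ∃ C : ℝ, 0 < C ∧ ∀ n : ℕ, n ≠ 0 → (n.divisors.card : ℝ) ≤ C * (n : ℝ) ^ ε := by
  set M : ℝ := 1 + 1 / (ε * Real.log 2)
  have hlog : 0 < Real.log 2 := Real.log_pos one_lt_two
  have hM1 : 1 ≤ M := by
    have : 0 ≤ 1 / (ε * Real.log 2) := by positivity
    linarith
  set N : ℕ := ⌈(2 : ℝ) ^ (1 / ε)⌉₊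
  refine ⟨M ^ N, by positivity, fun n hn => ?_⟩
  have hlocal : ∀ p ∈ n.primeFactors, ((n.factorization p : ℝ) + 1) ≤
      (if p < N then M else 1) * ((p : ℝ) ^ n.factorization p) ^ ε := by
    intro p hp
    split_ifs with h
    · exact natCast_add_one_le_mul_rpow hε
        (by exact_mod_cast (Nat.prime_of_mem_primeFactors hp).two_le) _
    · rw [one_mul]
      exact natCast_add_one_le_rpow hε (Nat.ceil_le.mp (not_lt.mp h)) _
  have hn_eq : (n : ℝ) = ∏ p ∈ n.primeFactors, (p : ℝ) ^ n.factorization p := by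
    conv_lhs => rw [← Nat.prod_factorization_pow_eq_self hn]
    simp [Finsupp.prod]
  have hconst : ∏ p ∈ n.primeFactors, (if p < N then M else 1) ≤ M ^ N := by
    rw [← prod_filter, prod_const]
    refine pow_le_pow_right₀ hM1 ?_
    calc #{p ∈ n.primeFactors | p < N} ≤ #(range N) :=
          card_le_card fun p hp => mem_range.mpr (mem_filter.mp hp).2
      _ = N := card_range N
  calc (n.divisors.card : ℝ) = ∏ p ∈ n.primeFactors, ((n.factorization p : ℝ) + 1) := by
        rw [Nat.card_divisors hn]
        push_cast
        rfl
    _ ≤ ∏ p ∈ n.primeFactors,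
          (if p < N then M else 1) * ((p : ℝ) ^ n.factorization p) ^ ε :=
        prod_le_prod (fun _ _ => by positivity) hlocal
    _ = (∏ p ∈ n.primeFactors, (if p < N then M else 1)) * (n : ℝ) ^ ε := by
        rw [prod_mul_distrib, Real.finsetProd_rpow _ _ (fun _ _ => by positivity), ← hn_eq]
    _ ≤ M ^ N * (n : ℝ) ^ ε := by gcongr

lemma flrt_pos (n : ℕ) : 0 < flrt n :=
  prod_pos fun _ hp => pow_pos (Nat.pos_of_mem_primeFactors hp) _

lemma flrt_sq_le {n : ℕ} (hn : n ≠ 0) : flrt n ^ 2 ≤ n := by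
  conv_rhs => rw [← Nat.prod_factorization_pow_eq_self hn]
  rw [flrt, ← prod_pow]
  refine prod_le_prod' fun p hp => ?_
  rw [← pow_mul]
  exact Nat.pow_le_pow_right (Nat.pos_of_mem_primeFactors hp) (Nat.div_mul_le_self _ 2)

/-- A prime power dividing `∏ p ^ ν_p(f p)` divides the corresponding `f q`, or is trivial. -/
lemma pow_dvd_of_dvd_prod_pow_factorization {c q k : ℕ} (hq : q.Prime) {f : ℕ → ℕ}
    (h : q ^ k ∣ ∏ p ∈ c.primeFactors, p ^ (f p).factorization p) : q ^ k ∣ f q := by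
  have hle := (hq.pow_dvd_iff_le_factorization (prod_ne_zero_iff.mpr fun p hp =>
    pow_ne_zero _ (Nat.prime_of_mem_primeFactors hp).ne_zero)).mp h
  have hval : (∏ p ∈ c.primeFactors, p ^ (f p).factorization p).factorization q
      = ∑ p ∈ c.primeFactors, if p = q then (f p).factorization p else 0 := by
    rw [Nat.factorization_prod_apply fun p hp =>
      pow_ne_zero _ (Nat.prime_of_mem_primeFactors hp).ne_zero]
    refine sum_congr rfl fun p hp => ?_
    rw [(Nat.prime_of_mem_primeFactors hp).factorization_pow, Finsupp.single_apply]
  rw [hval, sum_ite_eq'] at hle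
  refine (pow_dvd_pow q (hle.trans ?_)).trans (Nat.ordProj_dvd (f q) q)
  split_ifs <;> simp

/-- If `d` divides the products attached to `r ≤ s`, then `d ∣ 4 (s - r)`. -/
lemma dvd_four_mul_sub {c d r s : ℕ} (a : ℕ → ℤ) (hrs : r ≤ s)
    (hr : d ∣ ∏ p ∈ c.primeFactors, p ^ (((a p) ^ 2 + 4 * (r : ℤ)).natAbs.factorization p))
    (hs : d ∣ ∏ p ∈ c.primeFactors, p ^ (((a p) ^ 2 + 4 * (s : ℤ)).natAbs.factorization p)) :
    d ∣ 4 * (s - r) := by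
  refine (Nat.dvd_iff_prime_pow_dvd_dvd _ _).mpr fun q k hq hd => ?_
  have hpow : ∀ t : ℕ,
      d ∣ ∏ p ∈ c.primeFactors, p ^ (((a p) ^ 2 + 4 * (t : ℤ)).natAbs.factorization p) →
        ((q ^ k : ℕ) : ℤ) ∣ (a q) ^ 2 + 4 * (t : ℤ) := fun t ht =>
    Int.natCast_dvd.mpr (pow_dvd_of_dvd_prod_pow_factorization hq
      (f := fun p => ((a p) ^ 2 + 4 * (t : ℤ)).natAbs) (hd.trans ht))
  have hsub := dvd_sub (hpow s hs) (hpow r hr)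
  rw [add_sub_add_left_eq_sub, ← mul_sub, ← Nat.cast_sub hrs] at hsub
  exact_mod_cast hsub

/-- A subset of `[A, B]` whose differences satisfy `d ∣ 4 (s - r)` is sparse. -/
lemma mul_card_le_of_dvd_four_mul_sub {A B d : ℕ} (hAB : A ≤ B) {S : Finset ℕ}
    (hS : S ⊆ Icc A B) (hdvd : ∀ r ∈ S, ∀ s ∈ S, r ≤ s → d ∣ 4 * (s - r)) :
    d * #S ≤ 4 * (B - A) + d := by
  rcases S.eq_empty_or_nonempty with rfl | hne
  · simp
  rcases Nat.eq_zero_or_pos d with rfl | hd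
  · simp
  set m := S.min' hne
  have hm : m ∈ S := S.min'_mem hne
  have hmle : ∀ s ∈ S, m ≤ s := fun s hs => S.min'_le s hs
  have hcard : #S ≤ #(range (4 * (B - A) / d + 1)) := by
    refine card_le_card_of_injOn (fun s => 4 * (s - m) / d) (fun s hs => ?_)
      fun s hs t ht hst => ?_
    · have h₁ := mem_Icc.mp (hS hs)
      have h₂ := mem_Icc.mp (hS hm)
      simp only [coe_range, Set.mem_Iio, Nat.lt_succ_iff]
      exact Nat.div_le_div_right (by lia)
    · have h₁ := hmle s hs
      have h₂ := hmle t ht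
      have h := (Nat.div_left_inj (hdvd m hm s hs h₁) (hdvd m hm t ht h₂)).mp hst
      lia
  rw [card_range] at hcard
  calc d * #S ≤ d * (4 * (B - A) / d + 1) := Nat.mul_le_mul_left d hcard
    _ = d * (4 * (B - A) / d) + d := by ring
    _ ≤ 4 * (B - A) + d := Nat.add_le_add_right (Nat.mul_div_le _ _) d

/-- Averaging a gcd with `f` over an interval, under the sparsity hypothesis. -/
lemma sum_gcd_le {A B f : ℕ} (hAB : A ≤ B) (hf : f ≠ 0) (X : ℕ → ℕ)
    (hX : ∀ d r s, r ≤ s → d ∣ X r → d ∣ X s → d ∣ 4 * (s - r)) :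
    ∑ r ∈ Icc A B, Nat.gcd (X r) f ≤ #f.divisors * (4 * (B - A) + f) := by
  calc ∑ r ∈ Icc A B, Nat.gcd (X r) f
      ≤ ∑ r ∈ Icc A B, ∑ d ∈ f.divisors, if d ∣ X r then d else 0 := by
        refine sum_le_sum fun r _ => ?_
        have hmem : Nat.gcd (X r) f ∈ f.divisors :=
          Nat.mem_divisors.mpr ⟨Nat.gcd_dvd_right _ _, hf⟩
        have := single_le_sum (f := fun d => if d ∣ X r then d else 0)
          (fun _ _ => Nat.zero_le _) hmem
        simpa [Nat.gcd_dvd_left] using this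
    _ = ∑ d ∈ f.divisors, d * #{r ∈ Icc A B | d ∣ X r} := by
        rw [sum_comm]
        refine sum_congr rfl fun d _ => ?_
        rw [← sum_filter, sum_const, smul_eq_mul, mul_comm]
    _ ≤ ∑ d ∈ f.divisors, (4 * (B - A) + f) := by
        refine sum_le_sum fun d hd => ?_
        have hdf : d ≤ f := Nat.divisor_le hd
        have := mul_card_le_of_dvd_four_mul_sub (d := d) hAB
          (filter_subset (fun r => d ∣ X r) (Icc A B)) fun r hr s hs hrs =>
            hX d r s hrs (mem_filter.mp hr).2 (mem_filter.mp hs).2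
        lia
    _ = _ := by rw [sum_const, smul_eq_mul]

/-- on-average bound for `τ(r)·gcd(∏_{p ∣ c} p^{ν_p(a_p² + 4r)}, flrt c)`. -/
theorem sum_tau_gcd_discriminant_bound :
    ∀ ε : ℝ, 0 < ε → ∃ C : ℝ, 0 < C ∧
      ∀ A B c : ℕ, 1 ≤ A → A ≤ B → 1 ≤ c → ∀ a : ℕ → ℤ,
        (∑ r ∈ Finset.Icc A B,
            ((r.divisors.card : ℝ) *
              (Nat.gcd (∏ p ∈ c.primeFactors,
                  p ^ (((a p) ^ 2 + 4 * (r : ℤ)).natAbs.factorization p))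
                (flrt c) : ℝ)))
          ≤ C * (B : ℝ) ^ ε * (c : ℝ) ^ ε *
              ((B : ℝ) - (A : ℝ) + (c : ℝ) ^ ((1 : ℝ)/2)) := by
  intro ε hε
  obtain ⟨K, hK, hdiv⟩ := exists_card_divisors_le_rpow hε
  refine ⟨4 * K ^ 2, by positivity, fun A B c hA hAB hc a => ?_⟩
  have hsq : (flrt c : ℝ) ^ 2 ≤ c := by exact_mod_cast flrt_sq_le (by lia : c ≠ 0)
  have hsqrt : (flrt c : ℝ) ≤ (c : ℝ) ^ ((1 : ℝ) / 2) := by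
    rw [← Real.sqrt_eq_rpow]
    exact Real.le_sqrt_of_sq_le hsq
  have hflrt : (flrt c : ℝ) ≤ c :=
    le_trans (le_self_pow₀ (by exact_mod_cast flrt_pos c) two_ne_zero) hsq
  have hτ : ((flrt c).divisors.card : ℝ) ≤ K * (c : ℝ) ^ ε :=
    (hdiv _ (flrt_pos c).ne').trans (by gcongr)
  have hBA : (0 : ℝ) ≤ (B : ℝ) - A := sub_nonneg.mpr (by exact_mod_cast hAB)
  set X : ℕ → ℕ := fun r =>
    ∏ p ∈ c.primeFactors, p ^ (((a p) ^ 2 + 4 * (r : ℤ)).natAbs.factorization p)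
  have hgcd : ∑ r ∈ Icc A B, (Nat.gcd (X r) (flrt c) : ℝ)
      ≤ (flrt c).divisors.card * (4 * ((B : ℝ) - A) + flrt c) := by
    have := sum_gcd_le hAB (flrt_pos c).ne' X fun d r s hrs hr hs => dvd_four_mul_sub a hrs hr hs
    rw [← Nat.cast_sub hAB]
    exact_mod_cast this
  calc ∑ r ∈ Icc A B, (r.divisors.card : ℝ) * (Nat.gcd (X r) (flrt c) : ℝ)
      ≤ ∑ r ∈ Icc A B, K * (B : ℝ) ^ ε * (Nat.gcd (X r) (flrt c) : ℝ) := by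
        refine sum_le_sum fun r hr => ?_
        obtain ⟨h₁, h₂⟩ := mem_Icc.mp hr
        gcongr
        exact (hdiv r (by lia)).trans (by gcongr)
    _ = K * (B : ℝ) ^ ε * ∑ r ∈ Icc A B, (Nat.gcd (X r) (flrt c) : ℝ) := by rw [mul_sum]
    _ ≤ K * (B : ℝ) ^ ε * (K * (c : ℝ) ^ ε *
          (4 * ((B : ℝ) - A + (c : ℝ) ^ ((1 : ℝ) / 2)))) := by
        refine mul_le_mul_of_nonneg_left (hgcd.trans ?_) (by positivity)
        have : (0 : ℝ) ≤ flrt c := Nat.cast_nonneg _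
        exact mul_le_mul hτ (by linarith) (by linarith) (by positivity)
    _ = _ := by ring
end
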